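/- Trace-moment bound for pinched tensor-power states (used in the proof of Lemma 725): Let ρ and σ be density matrices on ℂ^k with σ positive definite. Let E^n be a PVM on (ℂ^k)^{⊗n} commuting with σ^{⊗n}, and let M^n be a PVM on (ℂ^k)^{⊗n} refining E^n. Then for every t with 0 < t ≤ 1, Tr( ρ^{⊗n} · (ℰ_{M^n}(σ^{⊗n}))^{−t} ) ≤ w(E^n)^t · ( Tr(ρ σ^{−t}) )^n, where matrix powers are taken by functional calculus. -/

import Mathlib

open scoped BigOperators Classical ComplexOrder
open Matrix Filter

noncomputable def matFun {d : Type*} [Fintype d] [DecidableEq d] (f : ℝ → ℝ)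
    (A : Matrix d d ℂ) : Matrix d d ℂ :=
  if hA : A.IsHermitian then hA.cfc f else 0

noncomputable def matLog {d : Type*} [Fintype d] [DecidableEq d]
    (A : Matrix d d ℂ) : Matrix d d ℂ :=
  matFun Real.log A

noncomputable def tensPow {k : ℕ} (ρ : Matrix (Fin k) (Fin k) ℂ) (n : ℕ) :
    Matrix (Fin n → Fin k) (Fin n → Fin k) ℂ :=
  fun x y => ∏ i, ρ (x i) (y i)

structure IsPVM {d ι : Type*} [Fintype d] [DecidableEq d] [Fintype ι]
    (E : ι → Matrix d d ℂ) : Prop where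
  herm : ∀ i, (E i).IsHermitian
  idem : ∀ i, E i * E i = E i
  ne_zero : ∀ i, E i ≠ 0
  orth : ∀ i j, i ≠ j → E i * E j = 0
  sum_one : ∑ i, E i = 1

noncomputable def pvmWidth {d ι : Type*} [Fintype d] [DecidableEq d] [Fintype ι]
    (E : ι → Matrix d d ℂ) : ℕ :=
  Finset.univ.sup fun i => (E i).rank

def Refines {d ι κ : Type*} [Fintype d] [DecidableEq d] [Fintype ι] [Fintype κ]
    (M : κ → Matrix d d ℂ) (E : ι → Matrix d d ℂ) : Prop :=
  ∃ f : κ → ι, ∀ i, E i = ∑ j ∈ Finset.univ.filter (fun j => f j = i), M j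

def IsTest {d : Type*} [Fintype d] [DecidableEq d] (A : Matrix d d ℂ) : Prop :=
  A.PosSemidef ∧ (1 - A).PosSemidef

noncomputable def pinch {d ι : Type*} [Fintype d] [DecidableEq d] [Fintype ι]
    (E : ι → Matrix d d ℂ) (A : Matrix d d ℂ) : Matrix d d ℂ :=
  ∑ i, E i * A * E i

/-- Quantum relative entropy `D(ρ‖σ) = Tr ρ (log ρ - log σ)`. -/
noncomputable def qRelEnt {d : Type*} [Fintype d] [DecidableEq d]
    (ρ σ : Matrix d d ℂ) : ℝ :=
  (Matrix.trace (ρ * (matLog ρ - matLog σ))).re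

section OperatorMonotone

open scoped Matrix.Norms.L2Operator MatrixOrder

/-- `a ↦ a ^ (-t)` is operator antitone on strictly positive elements for `0 < t ≤ 1`. -/
theorem CFC.rpow_neg_le_rpow_neg {A : Type*} [CStarAlgebra A] [PartialOrder A] [StarOrderedRing A]
    {a b : A} (ha : IsStrictlyPositive a) (hab : a ≤ b) {t : ℝ} (ht0 : 0 < t) (ht1 : t ≤ 1) :
    b ^ (-t) ≤ a ^ (-t) := by
  have hb : IsStrictlyPositive b := ⟨ha.nonneg.trans hab, CStarAlgebra.isUnit_of_le a hab⟩
  have h1 : a ^ t ≤ b ^ t := CFC.rpow_le_rpow ⟨ht0.le, ht1⟩ hab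
  have hat : IsStrictlyPositive (a ^ t) :=
    ⟨CFC.rpow_nonneg, (CFC.isUnit_rpow_iff a t ht0.ne' ha.nonneg).2 ha.isUnit⟩
  have h2 := CStarAlgebra.rpow_neg_one_le_rpow_neg_one h1 hat
  rwa [CFC.rpow_rpow _ _ _ ht0.ne' hb, CFC.rpow_rpow _ _ _ ht0.ne' ha, mul_neg_one] at h2

theorem matFun_eq_cfc {d : Type*} [Fintype d] [DecidableEq d] (f : ℝ → ℝ)
    {A : Matrix d d ℂ} (hA : A.IsHermitian) : matFun f A = cfc f A := by
  rw [matFun, dif_pos hA, hA.cfc_eq]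

theorem matFun_rpow_eq {d : Type*} [Fintype d] [DecidableEq d] (s : ℝ)
    {A : Matrix d d ℂ} (hA : A.PosSemidef) : matFun (fun x => Real.rpow x s) A = A ^ s := by
  rw [matFun_eq_cfc _ hA.1, CFC.rpow_eq_cfc_real (Matrix.nonneg_iff_posSemidef.2 hA)]
  rfl

theorem matFun_rpow_neg_le {d : Type*} [Fintype d] [DecidableEq d] {A B : Matrix d d ℂ}
    (hA : A.PosDef) (hAB : (B - A).PosSemidef) {t : ℝ} (ht0 : 0 < t) (ht1 : t ≤ 1) :
    (matFun (fun x => Real.rpow x (-t)) A - matFun (fun x => Real.rpow x (-t)) B).PosSemidef := by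
  have hB : B.PosSemidef := by simpa using hA.posSemidef.add hAB
  rw [matFun_rpow_eq _ hA.posSemidef, matFun_rpow_eq _ hB, ← Matrix.le_iff]
  exact CFC.rpow_neg_le_rpow_neg hA.isStrictlyPositive hAB ht0 ht1

theorem matFun_rpow_posSemidef {d : Type*} [Fintype d] [DecidableEq d] (s : ℝ)
    {A : Matrix d d ℂ} (hA : A.PosSemidef) : (matFun (fun x => Real.rpow x s) A).PosSemidef := by
  rw [matFun_rpow_eq _ hA, ← Matrix.nonneg_iff_posSemidef]
  exact CFC.rpow_nonneg

theorem exists_eq_conjTranspose_mul_self {d : Type*} [Fintype d] [DecidableEq d]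
    {A : Matrix d d ℂ} (hA : A.PosSemidef) : ∃ B : Matrix d d ℂ, A = Bᴴ * B :=
  CStarAlgebra.nonneg_iff_eq_star_mul_self.1 (Matrix.nonneg_iff_posSemidef.2 hA)

end OperatorMonotone

section FunctionalCalculus

variable {d : Type*} [Fintype d] [DecidableEq d]

theorem matFun_rpow_smul (s : ℝ) {A : Matrix d d ℂ} (hA : A.PosSemidef) {c : ℝ} (hc : 0 < c) :
    matFun (fun x => Real.rpow x s) (c • A) = (c ^ s) • matFun (fun x => Real.rpow x s) A := by
  have hcA : (c • A).PosSemidef := hA.smul hc.le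
  have hfin : (spectrum ℝ A).Finite := Matrix.finite_real_spectrum
  have hnn : ∀ x ∈ spectrum ℝ A, 0 ≤ x := by
    rw [hA.1.spectrum_real_eq_range_eigenvalues]
    rintro _ ⟨i, rfl⟩
    exact hA.eigenvalues_nonneg i
  have hA' : IsSelfAdjoint A := hA.1
  rw [matFun_eq_cfc _ hcA.1, matFun_eq_cfc _ hA.1,
    ← cfc_comp_smul c (fun x => Real.rpow x s) A ((hfin.image _).continuousOn _),
    ← cfc_smul _ _ _ (hfin.continuousOn _)]
  exact cfc_congr fun x hx => Real.mul_rpow hc.le (hnn x hx)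

/-- The functional calculus of a unitarily diagonalised matrix acts on the diagonal. -/
theorem matFun_conj_diagonal (f : ℝ → ℝ) (U : Matrix.unitaryGroup d ℂ) (v : d → ℝ) :
    matFun f (U.1 * diagonal (fun i => (v i : ℂ)) * star U.1) =
      U.1 * diagonal (fun i => (f (v i) : ℂ)) * star U.1 := by
  set A := U.1 * diagonal (fun i => (v i : ℂ)) * star U.1 with hAdef
  have hA : A.IsHermitian := by
    refine Matrix.isHermitian_mul_mul_conjTranspose _ ?_
    rw [Matrix.isHermitian_diagonal_iff]
    intro i
    simp [IsSelfAdjoint]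
  have hA' : IsSelfAdjoint A := hA
  have hfin : (spectrum ℝ A).Finite := Matrix.finite_real_spectrum
  set s : Finset ℝ := hfin.toFinset ∪ Finset.univ.image v
  obtain ⟨p, hp⟩ : ∃ p : Polynomial ℝ, ∀ x ∈ s, p.eval x = f x :=
    ⟨Lagrange.interpolate s id f, fun x hx =>
      Lagrange.eval_interpolate_at_node (v := id) f Function.injective_id.injOn hx⟩
  have h1 : cfc f A = cfc p.eval A := cfc_congr fun x hx => (hp x (by simp [s, hx])).symm
  have h2 : Unitary.conjStarAlgAut ℝ _ U (Matrix.diagonalAlgHom ℝ (fun i => (v i : ℂ))) = A := by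
    simp [Unitary.conjStarAlgAut_apply, hAdef]
  rw [matFun_eq_cfc _ hA, h1, cfc_polynomial p A hA']
  have h3 : Polynomial.aeval (fun i => (v i : ℂ)) p = fun i => (f (v i) : ℂ) := by
    rw [Polynomial.aeval_pi_apply]
    funext i
    rw [← hp (v i) (by simp [s])]
    exact Polynomial.aeval_algebraMap_apply_eq_algebraMap_eval (v i) p
  rw [← h2, Polynomial.aeval_algHom_apply, Polynomial.aeval_algHom_apply, h3]
  simp [Unitary.conjStarAlgAut_apply]

end FunctionalCalculus

section TensorPower

variable {k : ℕ}

theorem tensPow_mul (A B : Matrix (Fin k) (Fin k) ℂ) (n : ℕ) :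
    tensPow (A * B) n = tensPow A n * tensPow B n := by
  ext x y
  simp only [tensPow, Matrix.mul_apply, Finset.prod_univ_sum, Finset.prod_mul_distrib,
    Fintype.piFinset_univ]

theorem tensPow_diagonal (v : Fin k → ℂ) (n : ℕ) :
    tensPow (diagonal v) n = diagonal fun x => ∏ i, v (x i) := by
  ext x y
  by_cases h : x = y
  · subst h; simp [tensPow]
  · obtain ⟨i, hi⟩ := Function.ne_iff.1 h
    rw [diagonal_apply_ne _ h]
    exact Finset.prod_eq_zero (Finset.mem_univ i) (diagonal_apply_ne _ hi)

theorem tensPow_one (n : ℕ) : tensPow (1 : Matrix (Fin k) (Fin k) ℂ) n = 1 := by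
  rw [← diagonal_one, tensPow_diagonal]; simp

theorem tensPow_conjTranspose (A : Matrix (Fin k) (Fin k) ℂ) (n : ℕ) :
    tensPow Aᴴ n = (tensPow A n)ᴴ := by
  ext x y
  simp [tensPow, Matrix.conjTranspose_apply]

theorem trace_tensPow (A : Matrix (Fin k) (Fin k) ℂ) (n : ℕ) :
    (tensPow A n).trace = A.trace ^ n := by
  simp only [Matrix.trace, Matrix.diag, tensPow]
  rw [← Fin.prod_const, Finset.prod_univ_sum, Fintype.piFinset_univ]

theorem tensPow_posSemidef {A : Matrix (Fin k) (Fin k) ℂ} (hA : A.PosSemidef) (n : ℕ) :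
    (tensPow A n).PosSemidef := by
  obtain ⟨B, rfl⟩ := exists_eq_conjTranspose_mul_self hA
  rw [tensPow_mul, tensPow_conjTranspose]
  exact Matrix.posSemidef_conjTranspose_mul_self _

theorem tensPow_posDef {A : Matrix (Fin k) (Fin k) ℂ} (hA : A.PosDef) (n : ℕ) :
    (tensPow A n).PosDef := by
  rw [(tensPow_posSemidef hA.posSemidef n).posDef_iff_isUnit]
  obtain ⟨u, rfl⟩ := hA.isUnit
  refine IsUnit.of_mul_eq_one (tensPow (u⁻¹).1 n) ?_
  rw [← tensPow_mul, Units.mul_inv, tensPow_one]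

/-- The power `A ^ s` commutes with tensor powers. -/
theorem matFun_rpow_tensPow {A : Matrix (Fin k) (Fin k) ℂ} (hA : A.PosSemidef) (n : ℕ) (s : ℝ) :
    matFun (fun x => Real.rpow x s) (tensPow A n) =
      tensPow (matFun (fun x => Real.rpow x s) A) n := by
  have key : ∀ v : Fin k → ℝ, tensPow (hA.1.eigenvectorUnitary.1 * diagonal (fun i => (v i : ℂ)) *
      star hA.1.eigenvectorUnitary.1) n =
      tensPow hA.1.eigenvectorUnitary.1 n * diagonal (fun x => ((∏ i, v (x i) : ℝ) : ℂ)) *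
        star (tensPow hA.1.eigenvectorUnitary.1 n) := by
    intro v
    rw [tensPow_mul, tensPow_mul, tensPow_diagonal, star_eq_conjTranspose, star_eq_conjTranspose,
      tensPow_conjTranspose]
    push_cast
    rfl
  have hU : tensPow hA.1.eigenvectorUnitary.1 n ∈ Matrix.unitaryGroup (Fin n → Fin k) ℂ := by
    rw [Matrix.mem_unitaryGroup_iff, star_eq_conjTranspose, ← tensPow_conjTranspose, ← tensPow_mul,
      ← star_eq_conjTranspose, Matrix.mem_unitaryGroup_iff.1 hA.1.eigenvectorUnitary.2, tensPow_one]
  have hspec : A = hA.1.eigenvectorUnitary.1 * diagonal (fun i => (hA.1.eigenvalues i : ℂ)) *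
      star hA.1.eigenvectorUnitary.1 := hA.1.spectral_theorem
  have hfun : matFun (fun x => Real.rpow x s) A = hA.1.eigenvectorUnitary.1 *
      diagonal (fun i => (Real.rpow (hA.1.eigenvalues i) s : ℂ)) *
      star hA.1.eigenvectorUnitary.1 := by
    rw [matFun, dif_pos hA.1]
    rfl
  have hlhs : tensPow A n = _ := (congrArg (tensPow · n) hspec).trans (key _)
  rw [hlhs, hfun, key, matFun_conj_diagonal _ ⟨_, hU⟩]
  congr 4
  funext x
  congr 1
  exact (Real.finsetProd_rpow _ _ (fun i _ => hA.eigenvalues_nonneg _) s).symm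

end TensorPower

section Pinching

variable {d ι κ : Type*} [Fintype d]

/-- Cauchy–Schwarz form of the pinching inequality for finitely many Hermitian matrices. -/
theorem card_smul_sum_conj_sub_posSemidef (s : Finset κ) {M : κ → Matrix d d ℂ}
    (hM : ∀ j, (M j).IsHermitian) {A : Matrix d d ℂ} (hA : A.PosSemidef) :
    ((s.card : ℝ) • ∑ j ∈ s, M j * A * M j - (∑ j ∈ s, M j) * A * ∑ j ∈ s, M j).PosSemidef := by
  have h : (2 : ℝ)⁻¹ • ∑ i ∈ s, ∑ j ∈ s, (M i - M j) * A * (M i - M j) =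
      (s.card : ℝ) • ∑ j ∈ s, M j * A * M j - (∑ j ∈ s, M j) * A * ∑ j ∈ s, M j := by
    rw [inv_smul_eq_iff₀ two_ne_zero]
    simp only [sub_mul, mul_sub, Finset.sum_sub_distrib, Finset.sum_const, Finset.sum_mul,
      Finset.mul_sum, ← Finset.smul_sum]
    rw [Finset.sum_comm (f := fun i j => M j * A * M i)]
    simp only [← Nat.cast_smul_eq_nsmul ℝ]
    module
  rw [← h]
  refine Matrix.PosSemidef.smul (Matrix.posSemidef_sum _ fun i _ =>
    Matrix.posSemidef_sum _ fun j _ => ?_) (by norm_num)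
  simpa [((hM i).sub (hM j)).eq] using hA.mul_mul_conjTranspose_same (M i - M j)

variable [DecidableEq d]

theorem trace_mul_nonneg_of_posSemidef {A B : Matrix d d ℂ} (hA : A.PosSemidef)
    (hB : B.PosSemidef) : 0 ≤ (A * B).trace := by
  obtain ⟨C, rfl⟩ := exists_eq_conjTranspose_mul_self hA
  rw [Matrix.mul_assoc, Matrix.trace_mul_comm]
  exact (hB.mul_mul_conjTranspose_same C).trace_nonneg

theorem IsIdempotentElem.trace_eq_rank {P : Matrix d d ℂ} (hP : P * P = P) :
    P.trace = P.rank := by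
  have h : IsIdempotentElem (Matrix.toLin' P) := by
    rw [IsIdempotentElem, Module.End.mul_eq_comp, ← Matrix.toLin'_mul, hP]
  have := (LinearMap.IsIdempotentElem.isProj_range _ h).trace
  rw [Matrix.trace_toLin'_eq] at this
  exact this

theorem rank_pos_of_ne_zero {P : Matrix d d ℂ} (hP : P ≠ 0) : 0 < P.rank := by
  rw [Nat.pos_iff_ne_zero, Ne, Matrix.rank, Submodule.finrank_eq_zero, LinearMap.range_eq_bot]
  exact fun h => hP (Matrix.toLin'.injective (h.trans (map_zero _).symm))

variable [Fintype ι] [Fintype κ]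

theorem card_le_rank_sum {M : κ → Matrix d d ℂ} (hM : IsPVM M) (s : Finset κ) :
    s.card ≤ (∑ j ∈ s, M j).rank := by
  have hid : (∑ j ∈ s, M j) * ∑ j ∈ s, M j = ∑ j ∈ s, M j := by
    rw [Finset.sum_mul]
    refine Finset.sum_congr rfl fun i hi => ?_
    rw [Finset.mul_sum, Finset.sum_eq_single_of_mem i hi fun j _ hj => hM.orth i j hj.symm,
      hM.idem]
  have h : (∑ j ∈ s, M j).rank = ∑ j ∈ s, (M j).rank := by
    have := IsIdempotentElem.trace_eq_rank hid
    rw [Matrix.trace_sum, Finset.sum_congr rfl fun j _ =>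
      IsIdempotentElem.trace_eq_rank (hM.idem j)] at this
    exact_mod_cast this.symm
  rw [h, Finset.card_eq_sum_ones]
  exact Finset.sum_le_sum fun j _ => rank_pos_of_ne_zero (hM.ne_zero j)

theorem pinch_posSemidef {M : κ → Matrix d d ℂ} (hM : IsPVM M) {A : Matrix d d ℂ}
    (hA : A.PosSemidef) : (pinch M A).PosSemidef :=
  Matrix.posSemidef_sum _ fun j _ => by
    simpa [(hM.herm j).eq] using hA.mul_mul_conjTranspose_same (M j)

theorem pinch_eq_self {E : ι → Matrix d d ℂ} (hE : IsPVM E) {A : Matrix d d ℂ}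
    (hcomm : ∀ i, E i * A = A * E i) : pinch E A = A := by
  simp only [pinch, hcomm, Matrix.mul_assoc, hE.idem]
  rw [← Finset.mul_sum, hE.sum_one, Matrix.mul_one]

theorem pvmWidth_pos [Nonempty d] {E : ι → Matrix d d ℂ} (hE : IsPVM E) : 0 < pvmWidth E := by
  obtain ⟨i⟩ : Nonempty ι := by
    by_contra h
    rw [not_nonempty_iff] at h
    simpa using hE.sum_one
  exact (rank_pos_of_ne_zero (hE.ne_zero i)).trans_le
    (Finset.le_sup (f := fun i => (E i).rank) (Finset.mem_univ i))

/-- The pinching inequality `A ≤ w(E) ℰ_M(A)` when `M` refines `E` and `E` commutes with `A`. -/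
theorem width_smul_pinch_sub_posSemidef {E : ι → Matrix d d ℂ} {M : κ → Matrix d d ℂ}
    (hE : IsPVM E) (hM : IsPVM M) (hRef : Refines M E) {A : Matrix d d ℂ} (hA : A.PosSemidef)
    (hcomm : ∀ i, E i * A = A * E i) :
    ((pvmWidth E : ℝ) • pinch M A - A).PosSemidef := by
  obtain ⟨f, hf⟩ := hRef
  have hsum : (pvmWidth E : ℝ) • pinch M A - A = ∑ i, ((pvmWidth E : ℝ) •
      ∑ j ∈ Finset.univ.filter (fun j => f j = i), M j * A * M j - E i * A * E i) := by
    have hfib : ∑ i, ∑ j ∈ Finset.univ.filter (fun j => f j = i), M j * A * M j = pinch M A :=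
      Finset.sum_fiberwise Finset.univ f _
    rw [Finset.sum_sub_distrib, ← Finset.smul_sum, hfib]
    exact congrArg _ (pinch_eq_self hE hcomm).symm
  rw [hsum]
  refine Matrix.posSemidef_sum _ fun i _ => ?_
  set s := Finset.univ.filter (fun j => f j = i)
  have hcard : (s.card : ℝ) ≤ pvmWidth E := by
    refine Nat.cast_le.2 ((card_le_rank_sum hM s).trans ?_)
    rw [← hf i]
    exact Finset.le_sup (f := fun i => (E i).rank) (Finset.mem_univ i)
  have hpos : (∑ j ∈ s, M j * A * M j).PosSemidef := Matrix.posSemidef_sum _ fun j _ => by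
    simpa [(hM.herm j).eq] using hA.mul_mul_conjTranspose_same (M j)
  have h := (hpos.smul (sub_nonneg.2 hcard)).add (card_smul_sum_conj_sub_posSemidef s hM.herm hA)
  rw [hf i]
  convert! h using 1
  module

end Pinching

/-- **Trace-moment bound for pinched tensor-power states (used in Lemma 725).**
If the PVM `E` commutes with `σ^{⊗n}` and the PVM `M` refines `E`, then for `0 < t ≤ 1`,
`Tr(ρ^{⊗n} (ℰ_M(σ^{⊗n}))^{-t}) ≤ w(E)^t (Tr(ρ σ^{-t}))^n`. -/
theorem stmt_19 (k n : ℕ)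
    (ρ σ : Matrix (Fin k) (Fin k) ℂ)
    (hρ : ρ.PosSemidef) (hρ1 : ρ.trace = 1)
    (hσ : σ.PosDef) (hσ1 : σ.trace = 1)
    (ι κ : Type) [Fintype ι] [Fintype κ]
    (E : ι → Matrix (Fin n → Fin k) (Fin n → Fin k) ℂ)
    (M : κ → Matrix (Fin n → Fin k) (Fin n → Fin k) ℂ)
    (hE : IsPVM E) (hM : IsPVM M) (hRef : Refines M E)
    (hcomm : ∀ i, E i * tensPow σ n = tensPow σ n * E i)
    (t : ℝ) (ht0 : 0 < t) (ht1 : t ≤ 1) :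
    (Matrix.trace (tensPow ρ n *
        matFun (fun x : ℝ => Real.rpow x (-t)) (pinch M (tensPow σ n)))).re
      ≤ Real.rpow (pvmWidth E : ℝ) t *
        ((Matrix.trace (ρ * matFun (fun x : ℝ => Real.rpow x (-t)) σ)).re) ^ n := by
  have : Nonempty (Fin k) := by
    by_contra h
    rw [not_nonempty_iff] at h
    simp [Matrix.trace] at hρ1
  have hA := tensPow_posDef hσ n
  have hρn := tensPow_posSemidef hρ n
  have hw : (0 : ℝ) < pvmWidth E := Nat.cast_pos.2 (pvmWidth_pos hE)
  have hP := pinch_posSemidef hM hA.posSemidef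
  have hanti := matFun_rpow_neg_le hA
    (width_smul_pinch_sub_posSemidef hE hM hRef hA.posSemidef hcomm) ht0 ht1
  rw [matFun_rpow_smul _ hP hw, matFun_rpow_tensPow hσ.posSemidef] at hanti
  have htr := (Complex.le_def.1 (trace_mul_nonneg_of_posSemidef hρn hanti)).1
  rw [mul_sub, Matrix.trace_sub, ← tensPow_mul, trace_tensPow, mul_smul_comm, Matrix.trace_smul,
    Complex.sub_re, Complex.smul_re, Complex.zero_re, sub_nonneg, smul_eq_mul,
    Real.rpow_neg hw.le, inv_mul_le_iff₀ (Real.rpow_pos_of_pos hw t)] at htr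
  have hreal : (ρ * matFun (fun x => Real.rpow x (-t)) σ).trace =
      ((ρ * matFun (fun x => Real.rpow x (-t)) σ).trace.re : ℂ) := by
    refine Complex.ext rfl ?_
    exact (Complex.le_def.1 (trace_mul_nonneg_of_posSemidef hρ
      (matFun_rpow_posSemidef (-t) hσ.posSemidef))).2.symm
  rw [hreal, ← Complex.ofReal_pow, Complex.ofReal_re] at htr
  exact htr
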